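/- There exists a constant C > 0, depending only on d, such that for every k ∈ ℕ, every ℓ ≥ 1, every x ∈ A_k = [0, d^{-k}) and every n ≥ 2: if t_ℓ^α(x) = n, where t_0^α(x) = 0 and t_{ℓ+1}^α(x) = min{m ∈ ℕ : m > t_ℓ^α(x) and T_α^m(x) ∈ A_k} are the successive return times of x to A_k, then |n − ℓ·d^k·(1+α')| ≤ C·(1 + log n). -/

import Mathlib

open MeasureTheory Filter Topology Real

noncomputable section

/-- Partial sums `α^{(m-1)} = Σ_{j<m} α_j d^{-(j+1)}`. -/
def chaconPartial (d : ℕ) (a : ℕ → ℕ) (m : ℕ) : ℝ :=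
  ∑ j ∈ Finset.range m, (a j : ℝ) * (d : ℝ) ^ (-(j : ℤ) - 1)

/-- `α' = Σ_{j∈ℕ} α_j d^{-(j+1)}`. -/
def chaconSum (d : ℕ) (a : ℕ → ℕ) : ℝ :=
  ∑' j : ℕ, (a j : ℝ) * (d : ℝ) ^ (-(j : ℤ) - 1)

/-- The index `N(x)` of the unique member `Z_n` of the partition containing `x`:
for `x ∈ [0,1)` it is the unique `n` with `x ∈ [1-d^{-n}, 1-d^{-(n+1)})`, and for
`x ∈ [1, 1+α')` it is the unique `n` with `x ∈ [1+α^{(n-1)}, 1+α^{(n)})`. -/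
def chaconIndex (d : ℕ) (a : ℕ → ℕ) (x : ℝ) : ℕ :=
  if x < 1 then sInf {n : ℕ | x < 1 - (d : ℝ) ^ (-(n : ℤ) - 1)}
  else sInf {n : ℕ | x < 1 + chaconPartial d a (n + 1)}

/-- The Chacon transformation `T_α` on `[0, 1+α')`. -/
def chaconMap (d : ℕ) (a : ℕ → ℕ) (x : ℝ) : ℝ :=
  let n := chaconIndex d a x
  if x < 1 then
    if x < 1 - 2 * (d : ℝ) ^ (-(n : ℤ) - 1) then
      x - (1 - (d : ℝ) ^ (-(n : ℤ))) + (d : ℝ) ^ (-(n : ℤ) - 1)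
    else
      x + 2 * (d : ℝ) ^ (-(n : ℤ) - 1) + chaconPartial d a n
  else
    if 1 + chaconPartial d a (n + 1) - (d : ℝ) ^ (-(n : ℤ) - 1) ≤ x then
      x - (1 + chaconPartial d a (n + 1) - (d : ℝ) ^ (-(n : ℤ) - 1))
        + ((d : ℝ) - 1) * (d : ℝ) ^ (-(n : ℤ) - 1)
    else
      x + (d : ℝ) ^ (-(n : ℤ) - 1)

/-- Successive return times to `A_k = [0,d^{-k})`: `t_0(x) = 0` and
`t_{ℓ+1}(x) = min{m : m > t_ℓ(x) and T_α^m(x) ∈ A_k}`. -/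
def chaconReturnTime (d : ℕ) (a : ℕ → ℕ) (k : ℕ) (x : ℝ) : ℕ → ℕ
  | 0 => 0
  | ℓ + 1 =>
      sInf {m : ℕ | chaconReturnTime d a k x ℓ < m ∧
        (chaconMap d a)^[m] x ∈ Set.Ico (0 : ℝ) ((d : ℝ) ^ (-(k : ℤ)))}

/-- The number of leading digits `d - 1` in the base-`d` expansion of `y ∈ [0,1)`. -/
def leadIndex (d : ℕ) (y : ℝ) : ℕ :=
  sInf {n : ℕ | y < 1 - ((d : ℝ)⁻¹) ^ (n + 1)}

/-- The `d`-adic odometer on `[0,1)`. -/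
def odometer (d : ℕ) (y : ℝ) : ℝ :=
  y - (1 - ((d : ℝ)⁻¹) ^ leadIndex d y) + ((d : ℝ)⁻¹) ^ (leadIndex d y + 1)

/-- The first `m` base-`d` digits of `y ∈ [0,1)`, read as an integer with the leading digit
least significant. -/
def odometerCode (d : ℕ) : ℕ → ℝ → ℕ
  | 0, _ => 0
  | m + 1, y => ⌊(d : ℝ) * y⌋₊ + d * odometerCode d m ((d : ℝ) * y - ⌊(d : ℝ) * y⌋₊)

/-- The number of spacers between `y ∈ [0,1)` and its image under the odometer. -/
def spacerCount (d : ℕ) (a : ℕ → ℕ) (y : ℝ) : ℕ :=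
  if 1 - 2 * ((d : ℝ)⁻¹) ^ (leadIndex d y + 1) ≤ y then a (leadIndex d y) else 0

/-- The time of the `i`-th return to `[0,1)`. -/
def unitReturnTime (d : ℕ) (a : ℕ → ℕ) (x : ℝ) (i : ℕ) : ℕ :=
  ∑ j ∈ Finset.range i, (1 + spacerCount d a ((odometer d)^[j] x))

lemma zpow_neg_sub_one_eq (d n : ℕ) :
    (d : ℝ) ^ (-(n : ℤ) - 1) = ((d : ℝ)⁻¹) ^ (n + 1) := by
  rw [inv_pow, ← zpow_natCast, ← zpow_neg]
  congr 1
  push_cast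
  ring

lemma zpow_neg_eq (d n : ℕ) : (d : ℝ) ^ (-(n : ℤ)) = ((d : ℝ)⁻¹) ^ n := by
  rw [inv_pow, zpow_neg, zpow_natCast]

section Odometer

variable {d : ℕ} {y : ℝ}

lemma inv_base_pos (hd : 2 ≤ d) : 0 < (d : ℝ)⁻¹ :=
  inv_pos.2 (Nat.cast_pos.2 (by omega))

lemma inv_base_le_half (hd : 2 ≤ d) : (d : ℝ)⁻¹ ≤ 1 / 2 := by
  rw [inv_le_comm₀ (by positivity) (by positivity)]
  norm_num
  exact_mod_cast hd

lemma inv_base_pow_succ (hd : 2 ≤ d) (n : ℕ) :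
    2 * ((d : ℝ)⁻¹) ^ (n + 1) ≤ ((d : ℝ)⁻¹) ^ n := by
  have h := inv_base_le_half hd
  have h' : 0 < ((d : ℝ)⁻¹) ^ n := pow_pos (inv_base_pos hd) n
  rw [pow_succ]
  nlinarith

lemma inv_base_pow_anti (hd : 2 ≤ d) {m n : ℕ} (h : m ≤ n) :
    ((d : ℝ)⁻¹) ^ n ≤ ((d : ℝ)⁻¹) ^ m :=
  pow_le_pow_of_le_one (inv_base_pos hd).le ((inv_base_le_half hd).trans (by norm_num)) h

lemma leadIndex_eq (hd : 2 ≤ d) {n : ℕ} (h₁ : 1 - ((d : ℝ)⁻¹) ^ n ≤ y)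
    (h₂ : y < 1 - ((d : ℝ)⁻¹) ^ (n + 1)) : leadIndex d y = n := by
  refine le_antisymm (Nat.sInf_le h₂) (le_csInf ⟨n, h₂⟩ fun m hm => ?_)
  by_contra! hlt
  have hm' : y < 1 - ((d : ℝ)⁻¹) ^ (m + 1) := hm
  have := inv_base_pow_anti hd (show m + 1 ≤ n from hlt)
  linarith

lemma lt_of_leadIndex (hd : 2 ≤ d) (hy : y < 1) :
    y < 1 - ((d : ℝ)⁻¹) ^ (leadIndex d y + 1) := by
  have hne : {n : ℕ | y < 1 - ((d : ℝ)⁻¹) ^ (n + 1)}.Nonempty := by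
    obtain ⟨n, hn⟩ := exists_pow_lt_of_lt_one (sub_pos.2 hy)
      (show (d : ℝ)⁻¹ < 1 by linarith [inv_base_le_half hd])
    have := inv_base_pow_anti hd (show n ≤ n + 1 by omega)
    refine ⟨n, ?_⟩
    simp only [Set.mem_ofPred_eq]
    linarith
  exact Nat.sInf_mem hne

lemma le_of_leadIndex (hy : 0 ≤ y) : 1 - ((d : ℝ)⁻¹) ^ leadIndex d y ≤ y := by
  rcases h : leadIndex d y with _ | n
  · simpa using hy
  · have : n ∉ {n : ℕ | y < 1 - ((d : ℝ)⁻¹) ^ (n + 1)} :=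
      Nat.notMem_of_lt_sInf (show n < leadIndex d y by omega)
    simpa using this

lemma odometer_mem (hd : 2 ≤ d) (hy : y ∈ Set.Ico (0 : ℝ) 1) :
    odometer d y ∈ Set.Ico (0 : ℝ) 1 := by
  have h₁ := le_of_leadIndex (d := d) hy.1
  have h₂ := lt_of_leadIndex hd hy.2
  have h₃ : 0 < ((d : ℝ)⁻¹) ^ (leadIndex d y + 1) := pow_pos (inv_base_pos hd) _
  have h₄ := inv_base_pow_anti hd (Nat.zero_le (leadIndex d y))
  rw [pow_zero] at h₄
  constructor <;> unfold odometer <;> linarith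

lemma odometer_iterate_mem (hd : 2 ≤ d) (hy : y ∈ Set.Ico (0 : ℝ) 1) (i : ℕ) :
    (odometer d)^[i] y ∈ Set.Ico (0 : ℝ) 1 := by
  induction i with
  | zero => exact hy
  | succ i ih => rw [Function.iterate_succ_apply']; exact odometer_mem hd ih

lemma odometer_of_lt (hd : 2 ≤ d) (hy : 0 ≤ y) (h : y < 1 - (d : ℝ)⁻¹) :
    odometer d y = y + (d : ℝ)⁻¹ := by
  have : leadIndex d y = 0 := leadIndex_eq hd (by simpa using hy) (by simpa using h)
  simp [odometer, this]

lemma odometer_of_ge (hd : 2 ≤ d) (h : 1 - (d : ℝ)⁻¹ ≤ y) (hy : y < 1) :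
    odometer d y = (d : ℝ)⁻¹ * odometer d (d * y - (d - 1)) := by
  have hd0 : (0 : ℝ) < d := by positivity
  set z : ℝ := d * y - (d - 1) with hz
  have hyz : y = 1 - (d : ℝ)⁻¹ * (1 - z) := by rw [hz]; field_simp; ring
  have hδ := inv_base_pos hd
  have hz0 : 0 ≤ z := by nlinarith
  have hz1 : z < 1 := by nlinarith
  have h₁ := le_of_leadIndex (d := d) hz0
  have h₂ := lt_of_leadIndex hd hz1
  have : leadIndex d y = leadIndex d z + 1 := by
    apply leadIndex_eq hd
    · rw [hyz, pow_succ]; nlinarith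
    · rw [hyz, pow_succ]; nlinarith
  simp only [odometer, this]
  rw [hyz]
  ring

lemma floor_base_mul (hd : 2 ≤ d) (hy : y ∈ Set.Ico (0 : ℝ) 1) :
    ∃ j < d, ⌊(d : ℝ) * y⌋₊ = j ∧ (j : ℝ) ≤ d * y ∧ (d : ℝ) * y < j + 1 := by
  have hd0 : (0 : ℝ) < d := by positivity
  refine ⟨_, ?_, rfl, Nat.floor_le (mul_nonneg hd0.le hy.1), Nat.lt_floor_add_one _⟩
  rw [Nat.floor_lt (mul_nonneg hd0.le hy.1)]
  nlinarith [hy.2]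

lemma odometerCode_odometer (hd : 2 ≤ d) (m : ℕ) (hy : y ∈ Set.Ico (0 : ℝ) 1) :
    odometerCode d m (odometer d y) ≡ odometerCode d m y + 1 [MOD d ^ m] := by
  induction m generalizing y with
  | zero => simp [Nat.modEq_one]
  | succ m ih =>
    have hd0 : (0 : ℝ) < d := by positivity
    obtain ⟨j, hj, hfl, hj₁, hj₂⟩ := floor_base_mul hd hy
    by_cases hlt : j + 1 < d
    · have hlt' : (j : ℝ) + 2 ≤ d := by exact_mod_cast hlt
      have hy' : y < 1 - (d : ℝ)⁻¹ := by
        rw [lt_sub_iff_add_lt, ← mul_lt_mul_iff_right₀ hd0, mul_add, mul_inv_cancel₀ hd0.ne']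
        linarith
      have he : (d : ℝ) * odometer d y = d * y + 1 := by
        rw [odometer_of_lt hd hy.1 hy', mul_add, mul_inv_cancel₀ hd0.ne']
      simp only [odometerCode, he, Nat.floor_add_one (mul_nonneg hd0.le hy.1), hfl]
      push_cast
      rw [add_sub_add_right_eq_sub, add_right_comm]
    · have hj' : j + 1 = d := by omega
      have hjr : (j : ℝ) = d - 1 := by rw [← hj']; simp
      have hy' : 1 - (d : ℝ)⁻¹ ≤ y := by
        rw [sub_le_iff_le_add, ← mul_le_mul_iff_right₀ hd0, mul_add, mul_inv_cancel₀ hd0.ne']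
        linarith
      have hz : (d : ℝ) * y - (d - 1) ∈ Set.Ico (0 : ℝ) 1 := ⟨by linarith, by linarith⟩
      have he : (d : ℝ) * odometer d y = odometer d (d * y - (d - 1)) := by
        rw [odometer_of_ge hd hy' hy.2, mul_inv_cancel_left₀ hd0.ne']
      have hm := odometer_mem hd hz
      have hfl' : ⌊odometer d ((d : ℝ) * y - (d - 1))⌋₊ = 0 := Nat.floor_eq_zero.2 hm.2
      simp only [odometerCode, he, hfl, hfl', hjr, Nat.cast_zero, sub_zero, zero_add]
      have := (ih hz).mul_left' d
      rw [pow_succ']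
      convert this using 1
      rw [mul_add, mul_one]
      omega

lemma odometerCode_iterate (hd : 2 ≤ d) (m : ℕ) (hy : y ∈ Set.Ico (0 : ℝ) 1) (i : ℕ) :
    odometerCode d m ((odometer d)^[i] y) ≡ odometerCode d m y + i [MOD d ^ m] := by
  induction i with
  | zero => rfl
  | succ i ih =>
    rw [Function.iterate_succ_apply', ← add_assoc]
    exact (odometerCode_odometer hd m (odometer_iterate_mem hd hy i)).trans (ih.add_right 1)

lemma odometerCode_lt (hd : 2 ≤ d) (m : ℕ) (hy : y ∈ Set.Ico (0 : ℝ) 1) :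
    odometerCode d m y < d ^ m := by
  induction m generalizing y with
  | zero => simp [odometerCode]
  | succ m ih =>
    obtain ⟨j, hj, hfl, hj₁, hj₂⟩ := floor_base_mul hd hy
    have := ih (y := d * y - j) ⟨by linarith, by linarith⟩
    simp only [odometerCode, hfl, pow_succ']
    nlinarith

lemma odometerCode_eq_zero_iff (hd : 2 ≤ d) (m : ℕ) (hy : y ∈ Set.Ico (0 : ℝ) 1) :
    odometerCode d m y = 0 ↔ y < ((d : ℝ)⁻¹) ^ m := by
  induction m generalizing y with
  | zero => simpa [odometerCode] using hy.2
  | succ m ih =>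
    have hd0 : (0 : ℝ) < d := by positivity
    obtain ⟨j, hj, hfl, hj₁, hj₂⟩ := floor_base_mul hd hy
    have := ih (y := d * y - j) ⟨by linarith, by linarith⟩
    have hp : y < ((d : ℝ)⁻¹) ^ (m + 1) ↔ d * y < ((d : ℝ)⁻¹) ^ m := by
      rw [pow_succ', ← mul_lt_mul_iff_right₀ hd0, mul_inv_cancel_left₀ hd0.ne']
    have h1 := inv_base_pow_anti hd (Nat.zero_le m)
    rw [pow_zero] at h1
    simp only [odometerCode, hfl, Nat.add_eq_zero_iff, mul_eq_zero, this, hp]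
    constructor
    · rintro ⟨rfl, h | h⟩
      · omega
      · simpa using h
    · intro h
      have : j = 0 := by
        have : (j : ℝ) < 1 := by linarith
        exact_mod_cast Nat.lt_one_iff.1 (by exact_mod_cast this)
      subst this
      exact ⟨rfl, Or.inr (by simpa using h)⟩

lemma odometerCode_eq_max_of_le (hd : 2 ≤ d) (m : ℕ) (hy : y ∈ Set.Ico (0 : ℝ) 1)
    (h : 1 - ((d : ℝ)⁻¹) ^ m ≤ y) : odometerCode d m y + 1 = d ^ m := by
  induction m generalizing y with
  | zero => simp [odometerCode]
  | succ m ih =>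
    have hd0 : (0 : ℝ) < d := by positivity
    obtain ⟨j, hj, hfl, hj₁, hj₂⟩ := floor_base_mul hd hy
    have hp : d - ((d : ℝ)⁻¹) ^ m ≤ d * y := by
      rw [← mul_le_mul_iff_right₀ hd0, mul_sub, pow_succ', mul_inv_cancel_left₀ hd0.ne'] at h
      linarith
    have h1 := inv_base_pow_anti hd (Nat.zero_le m)
    rw [pow_zero] at h1
    have hj' : j + 1 = d := by
      have : (d : ℝ) < j + 2 := by linarith
      have : d < j + 2 := by exact_mod_cast this
      omega
    have hjr : (j : ℝ) = d - 1 := by rw [← hj']; simp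
    have := ih (y := d * y - j) ⟨by linarith, by linarith⟩ (by linarith)
    simp only [odometerCode, hfl, pow_succ', ← this]
    rw [mul_add, mul_one]
    omega

lemma odometerCode_spacer_iff (hd : 2 ≤ d) (m : ℕ) (hy : y ∈ Set.Ico (0 : ℝ) 1) :
    odometerCode d (m + 1) y + 1 = (d - 1) * d ^ m ↔
      1 - 2 * ((d : ℝ)⁻¹) ^ (m + 1) ≤ y ∧ y < 1 - ((d : ℝ)⁻¹) ^ (m + 1) := by
  have hd0 : (0 : ℝ) < d := by positivity
  induction m generalizing y with
  | zero =>
    obtain ⟨j, hj, hfl, hj₁, hj₂⟩ := floor_base_mul hd hy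
    simp only [odometerCode, hfl, mul_zero, add_zero, pow_zero, mul_one, zero_add, pow_one]
    have e1 : 1 - 2 * (d : ℝ)⁻¹ ≤ y ↔ (d : ℝ) - 2 ≤ d * y := by
      rw [← mul_le_mul_iff_right₀ hd0]; field_simp
    have e2 : y < 1 - (d : ℝ)⁻¹ ↔ d * y < (d : ℝ) - 1 := by
      rw [← mul_lt_mul_iff_right₀ hd0]; field_simp
    rw [e1, e2]
    constructor
    · intro h
      have : j + 2 = d := by omega
      have : (j : ℝ) + 2 = d := by exact_mod_cast this
      constructor <;> linarith
    · rintro ⟨h, h'⟩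
      have k1 : (d : ℝ) < j + 3 := by linarith
      have k2 : (j : ℝ) + 1 < d := by linarith
      have k1' : d < j + 3 := by exact_mod_cast k1
      have k2' : j + 1 < d := by exact_mod_cast k2
      omega
  | succ m ih =>
    obtain ⟨j, hj, hfl, hj₁, hj₂⟩ := floor_base_mul hd hy
    have hz : (d : ℝ) * y - j ∈ Set.Ico (0 : ℝ) 1 := ⟨by linarith, by linarith⟩
    have e1 : 1 - 2 * ((d : ℝ)⁻¹) ^ (m + 1 + 1) ≤ y ↔
        (d : ℝ) - 2 * ((d : ℝ)⁻¹) ^ (m + 1) ≤ d * y := by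
      rw [← mul_le_mul_iff_right₀ hd0, pow_succ' _ (m + 1), mul_sub, mul_left_comm (d : ℝ) 2,
        mul_inv_cancel_left₀ hd0.ne', mul_one]
    have e2 : y < 1 - ((d : ℝ)⁻¹) ^ (m + 1 + 1) ↔
        d * y < (d : ℝ) - ((d : ℝ)⁻¹) ^ (m + 1) := by
      rw [← mul_lt_mul_iff_right₀ hd0, pow_succ' _ (m + 1), mul_sub,
        mul_inv_cancel_left₀ hd0.ne', mul_one]
    rw [e1, e2]
    have h1 := inv_base_pow_succ hd m
    have h2 := inv_base_pow_anti hd (Nat.zero_le m)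
    rw [pow_zero] at h2
    have key : odometerCode d (m + 1 + 1) y + 1 = (d - 1) * d ^ (m + 1) ↔
        j + 1 = d ∧ odometerCode d (m + 1) (d * y - j) + 1 = (d - 1) * d ^ m := by
      rw [odometerCode, hfl]
      generalize odometerCode d (m + 1) (d * y - j) = c
      constructor
      · intro h
        have hdvd : d ∣ j + 1 := by
          have : d ∣ j + 1 + d * c := ⟨(d - 1) * d ^ m, by rw [pow_succ] at h; linarith⟩
          exact (Nat.dvd_add_left (dvd_mul_right d c)).1 this
        have hj' : j + 1 = d := le_antisymm hj (Nat.le_of_dvd (by omega) hdvd)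
        refine ⟨hj', Nat.eq_of_mul_eq_mul_left (by omega : 0 < d) ?_⟩
        rw [pow_succ] at h
        linarith
      · rintro ⟨hj', h⟩
        rw [pow_succ, ← mul_assoc, ← h, add_mul, one_mul, mul_comm c]
        omega
    refine key.trans ((and_congr_right' (ih hz)).trans ?_)
    constructor
    · rintro ⟨hj', h, h'⟩
      have hjr : (j : ℝ) = d - 1 := by rw [← hj']; simp
      constructor <;> linarith
    · rintro ⟨h, h'⟩
      have hj' : j + 1 = d := by
        have : (d : ℝ) < j + 2 := by linarith
        have : d < j + 2 := by exact_mod_cast this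
        omega
      have hjr : (j : ℝ) = d - 1 := by rw [← hj']; simp
      exact ⟨hj', by linarith, by linarith⟩

end Odometer

section Chacon

variable {d : ℕ} {a : ℕ → ℕ} {y : ℝ}

lemma chaconPartial_succ (n : ℕ) :
    chaconPartial d a (n + 1) = chaconPartial d a n + a n * ((d : ℝ)⁻¹) ^ (n + 1) := by
  rw [chaconPartial, Finset.sum_range_succ, zpow_neg_sub_one_eq d n]
  rfl

lemma chaconPartial_monotone : Monotone (chaconPartial d a) := by
  refine monotone_nat_of_le_succ fun n => ?_
  rw [chaconPartial, chaconPartial, Finset.sum_range_succ]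
  exact le_add_of_nonneg_right (by positivity)

lemma chaconPartial_nonneg (n : ℕ) : 0 ≤ chaconPartial d a n :=
  Finset.sum_nonneg fun _ _ => by positivity

lemma chaconIndex_of_lt (hy : y < 1) : chaconIndex d a y = leadIndex d y := by
  simp only [chaconIndex, if_pos hy, leadIndex, zpow_neg_sub_one_eq d]

lemma chaconIndex_spacer {n : ℕ} (h₁ : 1 + chaconPartial d a n ≤ y)
    (h₂ : y < 1 + chaconPartial d a (n + 1)) : chaconIndex d a y = n := by
  have h := chaconPartial_nonneg (d := d) (a := a) n
  rw [chaconIndex, if_neg (by linarith)]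
  refine le_antisymm (Nat.sInf_le h₂) (le_csInf ⟨n, h₂⟩ fun m hm => ?_)
  by_contra! hlt
  have hm' : y < 1 + chaconPartial d a (m + 1) := hm
  have := chaconPartial_monotone (d := d) (a := a) (show m + 1 ≤ n from hlt)
  linarith

lemma chaconMap_of_lt (hy : y < 1)
    (h : y < 1 - 2 * ((d : ℝ)⁻¹) ^ (leadIndex d y + 1)) :
    chaconMap d a y = odometer d y := by
  simp only [chaconMap, chaconIndex_of_lt hy, if_pos hy,
    zpow_neg_sub_one_eq d, zpow_neg_eq, if_pos h, odometer]

lemma chaconMap_of_ge (hy : y < 1)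
    (h : 1 - 2 * ((d : ℝ)⁻¹) ^ (leadIndex d y + 1) ≤ y) :
    chaconMap d a y =
      y + 2 * ((d : ℝ)⁻¹) ^ (leadIndex d y + 1) + chaconPartial d a (leadIndex d y) := by
  simp only [chaconMap, chaconIndex_of_lt hy, if_pos hy,
    zpow_neg_sub_one_eq d, if_neg h.not_gt]

lemma chaconMap_last_spacer (hd : 2 ≤ d) {n : ℕ} (h₁ : 1 + chaconPartial d a n ≤ y)
    (h₂ : y < 1 + chaconPartial d a (n + 1))
    (h : 1 + chaconPartial d a (n + 1) - ((d : ℝ)⁻¹) ^ (n + 1) ≤ y) :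
    chaconMap d a y = y - (1 + chaconPartial d a (n + 1)) + ((d : ℝ)⁻¹) ^ n := by
  have hP := chaconPartial_nonneg (d := d) (a := a) n
  have hd0 : (d : ℝ) ≠ 0 := by positivity
  simp only [chaconMap, chaconIndex_spacer h₁ h₂, if_neg (show ¬ y < 1 by linarith),
    zpow_neg_sub_one_eq d, if_pos h]
  rw [sub_mul, pow_succ', mul_inv_cancel_left₀ hd0]
  ring

lemma chaconMap_not_last_spacer (hd : 2 ≤ d) {n : ℕ} (h₁ : 1 + chaconPartial d a n ≤ y)
    (h : y < 1 + chaconPartial d a (n + 1) - ((d : ℝ)⁻¹) ^ (n + 1)) :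
    chaconMap d a y = y + ((d : ℝ)⁻¹) ^ (n + 1) := by
  have hP := chaconPartial_nonneg (d := d) (a := a) n
  have hδ := pow_pos (inv_base_pos hd) (n + 1)
  simp only [chaconMap, chaconIndex_spacer h₁ (show y < _ by linarith),
    if_neg (show ¬ y < 1 by linarith),
    zpow_neg_sub_one_eq d, if_neg h.not_ge]

lemma chaconMap_first_return (hd : 2 ≤ d) (ha : ∀ j, a j = 1 ∨ a j = 2)
    (hy : y ∈ Set.Ico (0 : ℝ) 1) :
    (chaconMap d a)^[1 + spacerCount d a y] y = odometer d y ∧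
      ∀ m, 0 < m → m < 1 + spacerCount d a y → 1 ≤ (chaconMap d a)^[m] y := by
  unfold spacerCount
  split_ifs with h
  · have hs := chaconPartial_succ (d := d) (a := a) (leadIndex d y)
    have hP := chaconPartial_nonneg (d := d) (a := a) (leadIndex d y)
    have hδ := pow_pos (inv_base_pos hd) (leadIndex d y + 1)
    have hlt := lt_of_leadIndex hd hy.2
    have hT := chaconMap_of_ge (a := a) hy.2 h
    unfold odometer
    generalize leadIndex d y = n at *
    rcases ha n with han | han <;> rw [han] at hs ⊢ <;> push_cast at hs
    · have hT₂ := chaconMap_last_spacer (a := a) (n := n) hd (y := chaconMap d a y)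
        (by linarith) (by linarith) (by linarith)
      constructor
      · change chaconMap d a (chaconMap d a y) = _
        rw [hT₂]
        linarith
      · intro m h₀ h₁
        obtain rfl : m = 1 := by omega
        change 1 ≤ chaconMap d a y
        linarith
    · have hT₂ := chaconMap_not_last_spacer (a := a) (n := n) hd (y := chaconMap d a y)
        (by linarith) (by linarith)
      have hT₃ := chaconMap_last_spacer (a := a) (n := n) hd
        (y := chaconMap d a (chaconMap d a y)) (by linarith) (by linarith) (by linarith)
      constructor
      · change chaconMap d a (chaconMap d a (chaconMap d a y)) = _
        rw [hT₃]
        linarith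
      · intro m h₀ h₁
        obtain rfl | rfl : m = 1 ∨ m = 2 := by omega
        · change 1 ≤ chaconMap d a y
          linarith
        · change 1 ≤ chaconMap d a (chaconMap d a y)
          linarith
  · exact ⟨chaconMap_of_lt hy.2 (not_le.1 h), fun m h₀ h₁ => by omega⟩

lemma unitReturnTime_succ (i : ℕ) : unitReturnTime d a y (i + 1) =
    unitReturnTime d a y i + (1 + spacerCount d a ((odometer d)^[i] y)) :=
  Finset.sum_range_succ _ _

lemma unitReturnTime_strictMono : StrictMono (unitReturnTime d a y) :=
  strictMono_nat_of_lt_succ fun i => by rw [unitReturnTime_succ]; omega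

lemma chaconMap_iterate_unitReturnTime (hd : 2 ≤ d) (ha : ∀ j, a j = 1 ∨ a j = 2)
    (hy : y ∈ Set.Ico (0 : ℝ) 1) (i : ℕ) :
    (chaconMap d a)^[unitReturnTime d a y i] y = (odometer d)^[i] y := by
  induction i with
  | zero => rfl
  | succ i ih =>
    rw [unitReturnTime_succ, add_comm, Function.iterate_add_apply, ih,
      (chaconMap_first_return hd ha (odometer_iterate_mem hd hy i)).1,
      Function.iterate_succ_apply']

lemma exists_eq_unitReturnTime (hd : 2 ≤ d) (ha : ∀ j, a j = 1 ∨ a j = 2)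
    (hy : y ∈ Set.Ico (0 : ℝ) 1) {m : ℕ} (hm : (chaconMap d a)^[m] y < 1) (I : ℕ)
    (hI : m < unitReturnTime d a y I) : ∃ i < I, m = unitReturnTime d a y i := by
  induction I with
  | zero => simp [unitReturnTime] at hI
  | succ I ih =>
    rcases lt_trichotomy m (unitReturnTime d a y I) with h | h | h
    · obtain ⟨i, hi, rfl⟩ := ih h
      exact ⟨i, by omega, rfl⟩
    · exact ⟨I, by omega, h⟩
    · obtain ⟨r, rfl⟩ := Nat.exists_eq_add_of_lt h
      rw [unitReturnTime_succ] at hI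
      have := (chaconMap_first_return hd ha (odometer_iterate_mem hd hy I)).2 (r + 1)
        (by omega) (by omega)
      rw [← chaconMap_iterate_unitReturnTime hd ha hy, ← Function.iterate_add_apply,
        show r + 1 + unitReturnTime d a y I = unitReturnTime d a y I + r + 1 by omega] at this
      linarith

lemma odometer_iterate_lt_iff (hd : 2 ≤ d) {k : ℕ}
    (hy : y ∈ Set.Ico (0 : ℝ) (((d : ℝ)⁻¹) ^ k)) (i : ℕ) :
    (odometer d)^[i] y < ((d : ℝ)⁻¹) ^ k ↔ d ^ k ∣ i := by
  have h1 := inv_base_pow_anti hd (Nat.zero_le k)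
  rw [pow_zero] at h1
  have hy' : y ∈ Set.Ico (0 : ℝ) 1 := ⟨hy.1, hy.2.trans_le h1⟩
  have hi := odometer_iterate_mem hd hy' i
  have h0 := (odometerCode_eq_zero_iff hd k hy').2 hy.2
  have hmod := odometerCode_iterate hd k hy' i
  rw [h0, zero_add] at hmod
  rw [← odometerCode_eq_zero_iff hd k hi, ← Nat.modEq_zero_iff_dvd]
  constructor
  · intro h
    rw [h] at hmod
    exact hmod.symm
  · intro h
    have := hmod.trans h
    exact Nat.eq_zero_of_dvd_of_lt ((Nat.modEq_zero_iff_dvd).1 this) (odometerCode_lt hd k hi)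

lemma chaconReturnTime_eq (hd : 2 ≤ d) (ha : ∀ j, a j = 1 ∨ a j = 2) {k : ℕ}
    (hy : y ∈ Set.Ico (0 : ℝ) (((d : ℝ)⁻¹) ^ k)) (l : ℕ) :
    chaconReturnTime d a k y l = unitReturnTime d a y (l * d ^ k) := by
  have h1 := inv_base_pow_anti hd (Nat.zero_le k)
  rw [pow_zero] at h1
  have hy' : y ∈ Set.Ico (0 : ℝ) 1 := ⟨hy.1, hy.2.trans_le h1⟩
  have hdk : 0 < d ^ k := by positivity
  induction l with
  | zero => simp [chaconReturnTime, unitReturnTime]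
  | succ l ih =>
    rw [chaconReturnTime, ih]
    have hmem : unitReturnTime d a y ((l + 1) * d ^ k) ∈
        {m : ℕ | unitReturnTime d a y (l * d ^ k) < m ∧
          (chaconMap d a)^[m] y ∈ Set.Ico (0 : ℝ) ((d : ℝ) ^ (-(k : ℤ)))} := by
      refine ⟨unitReturnTime_strictMono (by rw [add_mul]; omega), ?_⟩
      rw [chaconMap_iterate_unitReturnTime hd ha hy', zpow_neg_eq]
      exact ⟨(odometer_iterate_mem hd hy' _).1,
        (odometer_iterate_lt_iff hd hy _).2 (dvd_mul_left _ _)⟩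
    refine le_antisymm (Nat.sInf_le hmem) (le_csInf ⟨_, hmem⟩ ?_)
    rintro m ⟨hm₁, hm₂⟩
    rw [zpow_neg_eq] at hm₂
    by_contra! hlt
    obtain ⟨i, hi, rfl⟩ := exists_eq_unitReturnTime hd ha hy' (hm₂.2.trans_le h1) _ hlt
    rw [chaconMap_iterate_unitReturnTime hd ha hy'] at hm₂
    have hi' := unitReturnTime_strictMono.lt_iff_lt.1 hm₁
    obtain ⟨c, rfl⟩ := (odometer_iterate_lt_iff hd hy _).1 hm₂.2
    rw [mul_comm (d ^ k)] at hi hi'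
    have := Nat.lt_of_mul_lt_mul_right hi'
    have := Nat.lt_of_mul_lt_mul_right hi
    omega

lemma spacer_iff_leadIndex (hd : 2 ≤ d) (hy : y ∈ Set.Ico (0 : ℝ) 1) (m : ℕ) :
    odometerCode d (m + 1) y + 1 = (d - 1) * d ^ m ↔
      m = leadIndex d y ∧ 1 - 2 * ((d : ℝ)⁻¹) ^ (leadIndex d y + 1) ≤ y := by
  rw [odometerCode_spacer_iff hd m hy]
  constructor
  · rintro ⟨h, h'⟩
    have := leadIndex_eq hd (by linarith [inv_base_pow_succ hd m]) h'
    rw [this]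
    exact ⟨rfl, h⟩
  · rintro ⟨rfl, h⟩
    exact ⟨h, lt_of_leadIndex hd hy.2⟩

lemma spacerCount_bounds (hd : 2 ≤ d) (ha : ∀ j, a j = 1 ∨ a j = 2)
    (hy : y ∈ Set.Ico (0 : ℝ) 1) (M : ℕ) :
    (∑ m ∈ Finset.range M, if odometerCode d (m + 1) y + 1 = (d - 1) * d ^ m then a m else 0)
        ≤ spacerCount d a y ∧
      spacerCount d a y ≤
        (∑ m ∈ Finset.range M, if odometerCode d (m + 1) y + 1 = (d - 1) * d ^ m then a m else 0)
          + if odometerCode d M y = d ^ M - 1 then 2 else 0 := by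
  simp only [spacer_iff_leadIndex hd hy, ite_and, Finset.sum_ite_eq', Finset.mem_range,
    spacerCount]
  rcases lt_or_ge (leadIndex d y) M with h | h
  · simp [h]
  · have hc := odometerCode_eq_max_of_le hd M hy
      (by linarith [inv_base_pow_anti hd h, le_of_leadIndex (d := d) hy.1])
    have : odometerCode d M y = d ^ M - 1 := by omega
    rw [if_neg h.not_gt, if_pos this]
    have := ha (leadIndex d y)
    split_ifs <;> omega

lemma count_odometerCode (hd : 2 ≤ d) (hy : y ∈ Set.Ico (0 : ℝ) 1) (m L : ℕ) {v : ℕ}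
    (hv : v < d ^ m) :
    L / d ^ m ≤ ∑ i ∈ Finset.range L,
        (if odometerCode d m ((odometer d)^[i] y) = v then 1 else 0) ∧
      ∑ i ∈ Finset.range L, (if odometerCode d m ((odometer d)^[i] y) = v then 1 else 0)
        ≤ L / d ^ m + 1 := by
  have hp : 0 < d ^ m := by positivity
  set c := odometerCode d m y with hc
  have key : ∀ i, odometerCode d m ((odometer d)^[i] y) = v ↔
      i ≡ v + c * (d ^ m - 1) [MOD d ^ m] := by
    intro i
    have hmod := odometerCode_iterate hd m hy i
    have hsum : c + (v + c * (d ^ m - 1)) ≡ v [MOD d ^ m] := by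
      have : c + (v + c * (d ^ m - 1)) = v + d ^ m * c := by
        obtain ⟨p, hp'⟩ := Nat.exists_eq_add_of_lt hp
        rw [hp']
        simp only [zero_add, Nat.add_sub_cancel]
        ring
      rw [this]
      simp [Nat.ModEq]
    constructor
    · rintro h
      rw [h] at hmod
      exact Nat.ModEq.add_left_cancel' c (hmod.symm.trans hsum.symm)
    · intro h
      have := hmod.trans ((h.add_left c).trans hsum)
      exact this.eq_of_lt_of_lt (odometerCode_lt hd m (odometer_iterate_mem hd hy i)) hv
  simp only [key, Finset.sum_boole, Nat.cast_id]
  rw [← Nat.count_eq_card_filter_range, Nat.count_modEq_card _ hp]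
  split_ifs <;> omega

lemma abs_count_odometerCode_sub_le (hd : 2 ≤ d) (hy : y ∈ Set.Ico (0 : ℝ) 1) (m L : ℕ) {v : ℕ}
    (hv : v < d ^ m) :
    |((∑ i ∈ Finset.range L,
        if odometerCode d m ((odometer d)^[i] y) = v then 1 else 0 : ℕ) : ℝ)
      - L * ((d : ℝ)⁻¹) ^ m| ≤ 1 := by
  obtain ⟨h₁, h₂⟩ := count_odometerCode hd hy m L hv
  generalize (∑ i ∈ Finset.range L,
    if odometerCode d m ((odometer d)^[i] y) = v then 1 else 0 : ℕ) = N at *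
  have hp : (0 : ℝ) < (d : ℝ) ^ m := by positivity
  have e₁ : ((L / d ^ m : ℕ) : ℝ) ≤ L * ((d : ℝ)⁻¹) ^ m := by
    rw [inv_pow, ← div_eq_mul_inv]
    exact_mod_cast Nat.cast_div_le (α := ℝ) (m := L) (n := d ^ m)
  have e₂ : L * ((d : ℝ)⁻¹) ^ m < ((L / d ^ m : ℕ) : ℝ) + 1 := by
    rw [inv_pow, ← div_eq_mul_inv, div_lt_iff₀ hp]
    exact_mod_cast Nat.lt_mul_of_div_lt (Nat.lt_succ_self (L / d ^ m)) (by positivity)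
  have h₁' : ((L / d ^ m : ℕ) : ℝ) ≤ N := by exact_mod_cast h₁
  have h₂' : (N : ℝ) ≤ ((L / d ^ m : ℕ) : ℝ) + 1 := by exact_mod_cast h₂
  rw [abs_le]
  constructor <;> linarith

lemma chaconSum_bounds (hd : 2 ≤ d) (ha : ∀ j, a j = 1 ∨ a j = 2) (M : ℕ) :
    chaconPartial d a M ≤ chaconSum d a ∧
      chaconSum d a ≤ chaconPartial d a M + 2 * ((d : ℝ)⁻¹) ^ M := by
  have hδ := inv_base_pos hd
  have hδ' := inv_base_le_half hd
  have ha2 : ∀ j, (a j : ℝ) ≤ 2 := fun j => by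
    have : a j ≤ 2 := by have := ha j; omega
    exact_mod_cast this
  have hgeom := hasSum_geometric_of_lt_one hδ.le (by linarith)
  have hle : ∀ N j : ℕ, (a (j + N) : ℝ) * ((d : ℝ)⁻¹) ^ (j + N + 1) ≤
      2 * ((d : ℝ)⁻¹) ^ (N + 1) * ((d : ℝ)⁻¹) ^ j := fun N j => by
    rw [mul_assoc, ← pow_add, show N + 1 + j = j + N + 1 by omega]
    exact mul_le_mul_of_nonneg_right (ha2 _) (by positivity)
  have hsum : Summable fun j : ℕ => (a j : ℝ) * ((d : ℝ)⁻¹) ^ (j + 1) :=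
    Summable.of_nonneg_of_le (fun j => by positivity) (hle 0) (hgeom.summable.mul_left _)
  simp only [chaconPartial, chaconSum, zpow_neg_sub_one_eq d]
  rw [← hsum.sum_add_tsum_nat_add M]
  have hsum' := (summable_nat_add_iff M).2 hsum
  have h₁ : 0 ≤ ∑' j : ℕ, (a (j + M) : ℝ) * ((d : ℝ)⁻¹) ^ (j + M + 1) :=
    tsum_nonneg fun j => by positivity
  have h₂ : ∑' j : ℕ, (a (j + M) : ℝ) * ((d : ℝ)⁻¹) ^ (j + M + 1) ≤
      2 * ((d : ℝ)⁻¹) ^ (M + 1) * (1 - (d : ℝ)⁻¹)⁻¹ :=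
    hasSum_le (hle M) hsum'.hasSum (hgeom.mul_left _)
  have h₃ : 2 * ((d : ℝ)⁻¹) ^ (M + 1) * (1 - (d : ℝ)⁻¹)⁻¹ ≤ 2 * ((d : ℝ)⁻¹) ^ M := by
    rw [← div_eq_mul_inv, div_le_iff₀ (by linarith), pow_succ]
    have := pow_pos hδ M
    nlinarith
  constructor <;> linarith

lemma abs_unitReturnTime_sub_le (hd : 2 ≤ d) (ha : ∀ j, a j = 1 ∨ a j = 2)
    (hy : y ∈ Set.Ico (0 : ℝ) 1) {L M : ℕ} (hL : L < d ^ M) :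
    |(unitReturnTime d a y L : ℝ) - L * (1 + chaconSum d a)| ≤ 2 * M + 2 := by
  have ha2 : ∀ j, (a j : ℝ) ≤ 2 := fun j => by
    have : a j ≤ 2 := by have := ha j; omega
    exact_mod_cast this
  let N : ℕ → ℕ := fun m => ∑ i ∈ Finset.range L,
    if odometerCode d (m + 1) ((odometer d)^[i] y) = (d - 1) * d ^ m - 1 then 1 else 0
  have hpos : ∀ m, 0 < (d - 1) * d ^ m := fun m =>
    Nat.mul_pos (by omega) (Nat.pow_pos (by omega))
  have hlt : ∀ m, (d - 1) * d ^ m - 1 < d ^ (m + 1) := fun m => by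
    have h1 : (d - 1) * d ^ m ≤ d * d ^ m := Nat.mul_le_mul_right _ (by omega)
    rw [pow_succ']
    have := hpos m
    omega
  have hmain : ∑ i ∈ Finset.range L, ∑ m ∈ Finset.range M,
      (if odometerCode d (m + 1) ((odometer d)^[i] y) + 1 = (d - 1) * d ^ m then a m else 0) =
      ∑ m ∈ Finset.range M, a m * N m := by
    rw [Finset.sum_comm]
    refine Finset.sum_congr rfl fun m _ => ?_
    rw [Finset.mul_sum]
    refine Finset.sum_congr rfl fun i _ => ?_
    have := hpos m
    rw [mul_ite, mul_one, mul_zero]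
    exact if_congr (by omega) rfl rfl
  have hR : unitReturnTime d a y L =
      L + ∑ i ∈ Finset.range L, spacerCount d a ((odometer d)^[i] y) := by
    simp [unitReturnTime, Finset.sum_add_distrib]
  have hlow : ∑ m ∈ Finset.range M, a m * N m ≤
      ∑ i ∈ Finset.range L, spacerCount d a ((odometer d)^[i] y) := by
    rw [← hmain]
    exact Finset.sum_le_sum fun i _ =>
      (spacerCount_bounds hd ha (odometer_iterate_mem hd hy i) M).1
  have hupp : ∑ i ∈ Finset.range L, spacerCount d a ((odometer d)^[i] y) ≤
      ∑ m ∈ Finset.range M, a m * N m + 2 := by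
    have h := Finset.sum_le_sum fun i (_ : i ∈ Finset.range L) =>
      (spacerCount_bounds hd ha (odometer_iterate_mem hd hy i) M).2
    rw [Finset.sum_add_distrib, hmain] at h
    have hc := (count_odometerCode hd hy M L (v := d ^ M - 1)
      (Nat.sub_lt (Nat.pow_pos (by omega)) one_pos)).2
    rw [Nat.div_eq_of_lt hL] at hc
    have h2 : ∑ i ∈ Finset.range L,
        (if odometerCode d M ((odometer d)^[i] y) = d ^ M - 1 then 2 else 0) =
        2 * ∑ i ∈ Finset.range L,
          (if odometerCode d M ((odometer d)^[i] y) = d ^ M - 1 then 1 else 0) := by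
      simp only [Finset.mul_sum, mul_ite, mul_one, mul_zero]
    omega
  have hdev : |((∑ m ∈ Finset.range M, a m * N m : ℕ) : ℝ) - L * chaconPartial d a M|
      ≤ 2 * M := by
    simp only [chaconPartial, zpow_neg_sub_one_eq d]
    push_cast
    rw [Finset.mul_sum, ← Finset.sum_sub_distrib]
    refine (Finset.abs_sum_le_sum_abs _ _).trans ?_
    have : ∀ m ∈ Finset.range M,
        |(a m : ℝ) * N m - L * (a m * ((d : ℝ)⁻¹) ^ (m + 1))| ≤ 2 := fun m _ => by
      rw [show (a m : ℝ) * N m - L * (a m * ((d : ℝ)⁻¹) ^ (m + 1)) =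
        a m * (N m - L * ((d : ℝ)⁻¹) ^ (m + 1)) by ring, abs_mul, Nat.abs_cast]
      have h := abs_count_odometerCode_sub_le hd hy (m + 1) L (hlt m)
      calc (a m : ℝ) * |N m - L * ((d : ℝ)⁻¹) ^ (m + 1)| ≤ 2 * 1 :=
            mul_le_mul (ha2 m) h (abs_nonneg _) (by norm_num)
        _ = 2 := by norm_num
    refine (Finset.sum_le_sum this).trans ?_
    simp [mul_comm]
  obtain ⟨hs₁, hs₂⟩ := chaconSum_bounds hd ha M
  have hLd : (L : ℝ) * ((d : ℝ)⁻¹) ^ M ≤ 1 := by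
    rw [inv_pow, ← div_eq_mul_inv]
    exact div_le_one_of_le₀ (by exact_mod_cast hL.le) (by positivity)
  have hL0 : (0 : ℝ) ≤ L := Nat.cast_nonneg L
  have hs₁' := mul_le_mul_of_nonneg_left hs₁ hL0
  have hs₂' := mul_le_mul_of_nonneg_left hs₂ hL0
  rw [mul_add] at hs₂'
  rw [hR]
  have hlow' : ((∑ m ∈ Finset.range M, a m * N m : ℕ) : ℝ) ≤
      (∑ i ∈ Finset.range L, spacerCount d a ((odometer d)^[i] y) : ℕ) := by exact_mod_cast hlow
  have hupp' : ((∑ i ∈ Finset.range L, spacerCount d a ((odometer d)^[i] y) : ℕ) : ℝ) ≤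
      (∑ m ∈ Finset.range M, a m * N m : ℕ) + 2 := by exact_mod_cast hupp
  rw [abs_le] at hdev ⊢
  rw [Nat.cast_add]
  constructor <;> linarith [hdev.1, hdev.2]

lemma natLog_le_log (hd : 3 ≤ d) {L : ℕ} (hL : L ≠ 0) : (Nat.log d L : ℝ) ≤ Real.log L := by
  have h₁ : ((d ^ Nat.log d L : ℕ) : ℝ) ≤ L := by exact_mod_cast Nat.pow_log_le_self d hL
  have h₂ := Real.log_le_log (by positivity) h₁
  rw [Nat.cast_pow, Real.log_pow] at h₂
  have h₃ : 1 ≤ Real.log d := by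
    rw [Real.le_log_iff_exp_le (by positivity)]
    have : (3 : ℝ) ≤ d := by exact_mod_cast hd
    linarith [Real.exp_one_lt_d9]
  have h₄ : (0 : ℝ) ≤ Nat.log d L := Nat.cast_nonneg _
  nlinarith

end Chacon

/-- There is a constant `C > 0`, depending only on `d`, such that for all `k`, all `ℓ ≥ 1`,
all `x ∈ A_k = [0,d^{-k})` and all `n ≥ 2`: if the `ℓ`-th return time of `x` to `A_k`
equals `n`, then `|n − ℓ·d^k·(1+α')| ≤ C·(1 + log n)`. -/
theorem chacon_return_time_estimate (d : ℕ) (hd_odd : Odd d) (hd7 : 7 ≤ d) :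
    ∃ C : ℝ, 0 < C ∧
      ∀ (a : ℕ → ℕ), (∀ j, a j = 1 ∨ a j = 2) →
        ∀ (k ℓ : ℕ), 1 ≤ ℓ →
          ∀ x ∈ Set.Ico (0 : ℝ) ((d : ℝ) ^ (-(k : ℤ))),
            ∀ n : ℕ, 2 ≤ n → chaconReturnTime d a k x ℓ = n →
              |(n : ℝ) - (ℓ : ℝ) * (d : ℝ) ^ k * (1 + chaconSum d a)|
                ≤ C * (1 + Real.log n) := by
  have hd : 2 ≤ d := by omega
  refine ⟨4, by norm_num, fun a ha k l hl x hx n _ hret => ?_⟩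
  rw [zpow_neg_eq] at hx
  rw [chaconReturnTime_eq hd ha hx] at hret
  have h1 := inv_base_pow_anti hd (Nat.zero_le k)
  rw [pow_zero] at h1
  have hx' : x ∈ Set.Ico (0 : ℝ) 1 := ⟨hx.1, hx.2.trans_le h1⟩
  have hL0 : l * d ^ k ≠ 0 := by positivity
  have hest := abs_unitReturnTime_sub_le hd ha hx'
    (Nat.lt_pow_succ_log_self (show 1 < d by omega) (l * d ^ k))
  have hLn : l * d ^ k ≤ n := hret ▸ unitReturnTime_strictMono.le_apply
  have hlog : Real.log ((l * d ^ k : ℕ) : ℝ) ≤ Real.log n :=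
    Real.log_le_log (by exact_mod_cast Nat.pos_of_ne_zero hL0) (by exact_mod_cast hLn)
  have hlog₀ := natLog_le_log (show 3 ≤ d by omega) hL0
  have hlog₁ : (0 : ℝ) ≤ Nat.log d (l * d ^ k) := Nat.cast_nonneg _
  rw [hret] at hest
  push_cast at hest
  push_cast at hlog hlog₀ hlog₁
  linarith

end
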